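/- arXiv:2604.07278 — 4 statements merged into one kernel-verified Lean document; each statement's English description precedes it below -/
import Mathlib

section
/- For any two ordered plantings S and T, ⟨D̂_S, D̂_T⟩ = p²·((1/t²)·∑_{i=1}^t ∑_{j=1}^t 2^{λ_{ij}} − 1). -/
open Finset

/-- An ordered planting: `t` pairwise disjoint `k`-element subsets of `[n]`. -/
def IsPlanting (n k t : ℕ) (S : Fin t → Finset (Fin n)) : Prop :=
  (∀ i, (S i).card = k) ∧ ∀ i j : Fin t, i ≠ j → Disjoint (S i) (S j)

/-- The planted distribution `𝖣_S` on `{0,1}ⁿ`: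
`𝖣_S(x) = (1 − p)·2^{−n} + (p/t)·∑_i 2^{−(n−k)}·1[x_v = 1 ∀ v ∈ S_i]` with `p = kt/n`. -/
noncomputable def DS (n k t : ℕ) (S : Fin t → Finset (Fin n)) (x : Fin n → Bool) : ℝ :=
  (1 - (k * t : ℝ) / n) * (2 : ℝ)⁻¹ ^ n +
    ((k * t : ℝ) / n) / t *
      ∑ i : Fin t, (2 : ℝ)⁻¹ ^ (n - k) * (if ∀ v ∈ S i, x v = true then 1 else 0)

/-- `D̂_S(x) = 𝖣_S(x)/𝒟₀(x) − 1` where `𝒟₀` is uniform on `{0,1}ⁿ`. -/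
noncomputable def Dhat (n k t : ℕ) (S : Fin t → Finset (Fin n)) (x : Fin n → Bool) : ℝ :=
  DS n k t S x / (2 : ℝ)⁻¹ ^ n - 1

/-- `⟨f,g⟩ = 2^{−n} ∑_{x ∈ {0,1}ⁿ} f(x) g(x)`. -/
noncomputable def innerD (n : ℕ) (f g : (Fin n → Bool) → ℝ) : ℝ :=
  (2 : ℝ)⁻¹ ^ n * ∑ x : Fin n → Bool, f x * g x

/-- The probability that a uniform point of the cube is `1` on all of `A`. -/
lemma uniform_mean_allOnes (n : ℕ) (A : Finset (Fin n)) :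
    (2 : ℝ)⁻¹ ^ n * ∑ x : Fin n → Bool, (if ∀ v ∈ A, x v = true then (1 : ℝ) else 0) =
      (2 : ℝ)⁻¹ ^ A.card := by
  have hprod : ∀ x : Fin n → Bool, (if ∀ v ∈ A, x v = true then (1 : ℝ) else 0) =
      ∏ v, (if v ∈ A → x v = true then (1 : ℝ) else 0) := fun x => by
    rw [Finset.prod_ite_zero]
    simp
  have hcoord : ∀ v, ∑ b : Bool, (if v ∈ A → b = true then (1 : ℝ) else 0) =
      2 * (if v ∈ A then (2 : ℝ)⁻¹ else 1) := fun v => by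
    by_cases hv : v ∈ A <;> simp [hv]
  simp_rw [hprod]
  rw [← Fintype.prod_sum (fun v (b : Bool) => if v ∈ A → b = true then (1 : ℝ) else 0)]
  simp_rw [hcoord]
  rw [Finset.prod_mul_distrib, Finset.prod_const, Finset.card_univ, Fintype.card_fin, ← mul_assoc,
    ← mul_pow, inv_mul_cancel₀ two_ne_zero, one_pow, one_mul, Finset.prod_ite_mem,
    Finset.univ_inter, Finset.prod_const]

lemma uniform_mean_allOnes_mul (n : ℕ) (A B : Finset (Fin n)) :
    (2 : ℝ)⁻¹ ^ n * ∑ x : Fin n → Bool, ((if ∀ v ∈ A, x v = true then (1 : ℝ) else 0) *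
      (if ∀ v ∈ B, x v = true then (1 : ℝ) else 0)) = (2 : ℝ)⁻¹ ^ (A ∪ B).card := by
  rw [← uniform_mean_allOnes]
  congr 1
  refine Finset.sum_congr rfl fun x _ => ?_
  simp only [Finset.forall_mem_union, ite_and, mul_ite, mul_one, mul_zero]
  split_ifs <;> rfl

/-- The covariance of the normalised indicators of two planted `k`-sets. -/
lemma innerD_allOnes_sub_one (n k : ℕ) (A B : Finset (Fin n)) (hA : A.card = k)
    (hB : B.card = k) :
    innerD n (fun x => (2 : ℝ) ^ k * (if ∀ v ∈ A, x v = true then (1 : ℝ) else 0) - 1)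
      (fun x => (2 : ℝ) ^ k * (if ∀ v ∈ B, x v = true then (1 : ℝ) else 0) - 1) =
      (2 : ℝ) ^ (A ∩ B).card - 1 := by
  have hAm := uniform_mean_allOnes n A
  have hBm := uniform_mean_allOnes n B
  have hABm := uniform_mean_allOnes_mul n A B
  have h1 : (2 : ℝ)⁻¹ ^ n * ∑ _x : Fin n → Bool, (1 : ℝ) = 1 := by
    simp
  have hk : (2 : ℝ) ^ k * (2 : ℝ)⁻¹ ^ k = 1 := by
    rw [← mul_pow, mul_inv_cancel₀ two_ne_zero, one_pow]
  have hcard : (2 : ℝ) ^ k * (2 : ℝ) ^ k * (2 : ℝ)⁻¹ ^ (A ∪ B).card =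
      (2 : ℝ) ^ (A ∩ B).card := by
    rw [← pow_add, ← congrArg₂ (· + ·) hA hB, ← Finset.card_union_add_card_inter, pow_add,
      mul_right_comm, ← mul_pow, mul_inv_cancel₀ two_ne_zero, one_pow, one_mul]
  rw [hA] at hAm
  rw [hB] at hBm
  have hexp : ∀ a b : ℝ, ((2 : ℝ) ^ k * a - 1) * ((2 : ℝ) ^ k * b - 1) =
      (2 : ℝ) ^ k * (2 : ℝ) ^ k * (a * b) - (2 : ℝ) ^ k * a - (2 : ℝ) ^ k * b + 1 := by
    intros; ring
  unfold innerD
  simp only [hexp, Finset.sum_add_distrib, Finset.sum_sub_distrib, ← Finset.mul_sum]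
  linear_combination (2 : ℝ) ^ k * (2 : ℝ) ^ k * hABm - (2 : ℝ) ^ k * hAm - (2 : ℝ) ^ k * hBm +
    h1 + hcard - 2 * hk

lemma Dhat_eq_sum (n k t : ℕ) (ht : 0 < t) (hkn : k ≤ n) (S : Fin t → Finset (Fin n))
    (x : Fin n → Bool) :
    Dhat n k t S x = ((k * t : ℝ) / n) / t *
      ∑ i : Fin t, ((2 : ℝ) ^ k * (if ∀ v ∈ S i, x v = true then (1 : ℝ) else 0) - 1) := by
  have ht' : (t : ℝ) ≠ 0 := by positivity
  have hpow : (2 : ℝ)⁻¹ ^ (n - k) = (2 : ℝ)⁻¹ ^ n * (2 : ℝ) ^ k := by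
    rw [← Nat.sub_add_cancel hkn, pow_add, Nat.add_sub_cancel, mul_assoc, ← mul_pow,
      inv_mul_cancel₀ two_ne_zero, one_pow, mul_one]
  have h2 : (2 : ℝ)⁻¹ ^ n ≠ 0 := by positivity
  unfold Dhat DS
  simp only [hpow, mul_assoc, ← Finset.mul_sum, Finset.sum_sub_distrib, Finset.sum_const,
    Finset.card_univ, Fintype.card_fin, nsmul_eq_mul, mul_one]
  generalize (k * t : ℝ) / n = p
  field_simp
  ring

lemma innerD_sum_sum {ι κ : Type*} [Fintype ι] [Fintype κ] (n : ℕ) (c d : ℝ)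
    (f : ι → (Fin n → Bool) → ℝ) (g : κ → (Fin n → Bool) → ℝ) :
    innerD n (fun x => c * ∑ i, f i x) (fun x => d * ∑ j, g j x) =
      c * d * ∑ i, ∑ j, innerD n (f i) (g j) := by
  unfold innerD
  simp only [mul_mul_mul_comm c, ← Finset.mul_sum, Finset.sum_mul_sum]
  rw [Finset.sum_comm, mul_left_comm]
  congr 2
  refine Finset.sum_congr rfl fun i _ => ?_
  simp only [Finset.mul_sum]
  exact Finset.sum_comm

/-- For any two ordered plantings `S`, `T`,
`⟨D̂_S, D̂_T⟩ = p² ((1/t²) ∑_{i,j} 2^{λ_{ij}} − 1)` where `λ_{ij} = |S_i ∩ T_j|`. -/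
theorem pairwise_correlation_identity (n k t : ℕ) (hn : 0 < n) (hk : 0 < k) (ht : 0 < t)
    (hkt : k * t ≤ n) (S T : Fin t → Finset (Fin n))
    (hS : IsPlanting n k t S) (hT : IsPlanting n k t T) :
    innerD n (Dhat n k t S) (Dhat n k t T) =
      ((k * t : ℝ) / n) ^ 2 *
        ((1 / (t : ℝ) ^ 2) * ∑ i : Fin t, ∑ j : Fin t, (2 : ℝ) ^ ((S i ∩ T j).card) - 1) := by
  have ht' : (t : ℝ) ≠ 0 := by positivity
  have hkn : k ≤ n := (Nat.le_mul_of_pos_right k ht).trans hkt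
  rw [funext (Dhat_eq_sum n k t ht hkn S), funext (Dhat_eq_sum n k t ht hkn T), innerD_sum_sum]
  simp only [fun i j => innerD_allOnes_sub_one n k (S i) (T j) (hS.1 i) (hT.1 j),
    Finset.sum_sub_distrib, Finset.sum_const, Finset.card_univ, Fintype.card_fin, nsmul_eq_mul,
    mul_one]
  generalize (k * t : ℝ) / n = p
  field_simp
end

section
/- Let 1 ≤ K ≤ n, let U ⊆ [n] be a fixed set with |U| = K, let V be a uniformly random K-element subset of [n], and let X = |U ∩ V|. Then for every integer j ≥ 0, ℙ[X ≥ j] ≤ C(K, j)·(K/n)^j. -/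
open Finset

/-- For `j ≤ k ≤ n`, the ratio `C(n - j, k - j) / C(n, k)` is at most `(k / n) ^ j`. -/
theorem choose_sub_sub_mul_pow_le {n k j : ℕ} (hkn : k ≤ n) (hjk : j ≤ k) :
    (n - j).choose (k - j) * n ^ j ≤ n.choose k * k ^ j := by
  induction j with
  | zero => simp
  | succ j ih =>
    obtain ⟨b, rfl⟩ := Nat.exists_eq_add_of_le hjk
    obtain ⟨a, rfl⟩ := Nat.exists_eq_add_of_le hkn
    have ih := ih (by omega)
    rw [show j + 1 + b + a - j = b + a + 1 by omega, show j + 1 + b - j = b + 1 by omega] at ih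
    rw [show j + 1 + b + a - (j + 1) = b + a by omega, show j + 1 + b - (j + 1) = b by omega]
    have hc := Nat.add_one_mul_choose_eq (b + a) b
    have hr : (b + 1) * (j + 1 + b + a) ≤ (j + 1 + b) * (b + a + 1) := by nlinarith
    generalize j + 1 + b + a = n at *
    generalize j + 1 + b = k at *
    refine le_of_mul_le_mul_left ?_ (Nat.succ_pos (b + a))
    calc (b + a + 1) * ((b + a).choose b * n ^ (j + 1))
        = (b + a + 1) * (b + a).choose b * n ^ (j + 1) := by ring
      _ = (b + a + 1).choose (b + 1) * n ^ j * ((b + 1) * n) := by rw [hc]; ring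
      _ ≤ (n.choose k * k ^ j) * (k * (b + a + 1)) := Nat.mul_le_mul ih hr
      _ = (b + a + 1) * (n.choose k * k ^ (j + 1)) := by ring

/-- Union bound over the `j`-element subsets of `U` for the number of `k`-element sets meeting `U`
in at least `j` elements. -/
theorem card_filter_le_card_inter_le {α : Type*} [Fintype α] [DecidableEq α]
    (U : Finset α) (k j : ℕ) :
    #{V : Finset α | #V = k ∧ j ≤ #(U ∩ V)} ≤
      (#U).choose j * (Fintype.card α - j).choose (k - j) := by
  have hsub : ({V : Finset α | #V = k ∧ j ≤ #(U ∩ V)} : Finset (Finset α)) ⊆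
      (powersetCard j U).biUnion fun S ↦ (powersetCard (k - j) Sᶜ).image (S ∪ ·) := by
    intro V hV
    obtain ⟨hVk, hVj⟩ := (mem_filter.1 hV).2
    obtain ⟨S, hS, hSj⟩ := exists_subset_card_eq hVj
    have hSV : S ⊆ V := hS.trans inter_subset_right
    refine mem_biUnion.2 ⟨S, mem_powersetCard.2 ⟨hS.trans inter_subset_left, hSj⟩,
      mem_image.2 ⟨V \ S, mem_powersetCard.2 ⟨?_, ?_⟩, union_sdiff_of_subset hSV⟩⟩
    · intro x hx
      simp_all
    · rw [card_sdiff_of_subset hSV, hVk, hSj]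
  refine (card_le_card hsub).trans ?_
  rw [← card_powersetCard]
  refine card_biUnion_le_card_mul _ _ _ fun S hS ↦ card_image_le.trans ?_
  rw [card_powersetCard, card_compl, (mem_powersetCard.1 hS).2]

/-- Hypergeometric tail bound: for `1 ≤ K ≤ n`, a fixed `U ⊆ [n]` with `|U| = K`, a uniformly
random `K`-element subset `V` of `[n]`, and `X = |U ∩ V|`, for every `j ≥ 0` we have
`ℙ[X ≥ j] ≤ C(K,j)·(K/n)^j`. -/
theorem hypergeometric_tail_bound (n K : ℕ) (hK1 : 1 ≤ K) (hKn : K ≤ n)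
    (U : Finset (Fin n)) (hU : U.card = K) (j : ℕ) :
    (Nat.card {V : Finset (Fin n) // V.card = K ∧ j ≤ (U ∩ V).card} : ℝ) /
        (n.choose K : ℝ) ≤
      (K.choose j : ℝ) * ((K : ℝ) / (n : ℝ)) ^ j := by
  have hcard := card_filter_le_card_inter_le U K j
  rw [hU, Fintype.card_fin] at hcard
  rw [Nat.card_eq_fintype_card, Fintype.card_subtype, div_pow, ← mul_div_assoc,
    div_le_div_iff₀ (mod_cast Nat.choose_pos hKn) (pow_pos (mod_cast hK1.trans hKn) j)]
  norm_cast
  rcases le_or_gt j K with hj | hj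
  · calc _ ≤ K.choose j * (n - j).choose (K - j) * n ^ j := Nat.mul_le_mul_right _ hcard
      _ = K.choose j * ((n - j).choose (K - j) * n ^ j) := mul_assoc _ _ _
      _ ≤ K.choose j * (n.choose K * K ^ j) :=
        Nat.mul_le_mul_left _ (choose_sub_sub_mul_pow_le hKn hj)
      _ = _ := by ring
  · rw [Nat.choose_eq_zero_of_lt hj, zero_mul, Nat.le_zero] at hcard
    simp [hcard]
end

section
/- Let 1 ≤ K ≤ n, let U ⊆ [n] be a fixed set with |U| = K, let V be a uniformly random K-element subset of [n], and let X = |U ∩ V|. Then for every integer ℓ ≥ 0, E[2^X · 1{X > ℓ}] = ∑_{x=ℓ+1}^{K} 2^x·ℙ[X = x] ≤ ∑_{j=ℓ+1}^{∞} (2K²/n)^j / j!. -/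
open Finset

/-- `ℙ[|U ∩ V| = x]` for `V` a uniformly random `K`-element subset of `[n]`. -/
noncomputable def hyperProb (n K : ℕ) (U : Finset (Fin n)) (x : ℕ) : ℝ :=
  (Nat.card {V : Finset (Fin n) // V.card = K ∧ (U ∩ V).card = x} : ℝ) /
    (n.choose K : ℝ)

/-- `E[2^X · 1{X > ℓ}]` for `X = |U ∩ V|`, `V` a uniformly random `K`-subset of `[n]`. -/
noncomputable def truncExp (n K : ℕ) (U : Finset (Fin n)) (ℓ : ℕ) : ℝ :=
  (∑ V ∈ Finset.univ.filter (fun V : Finset (Fin n) => V.card = K),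
      (if ℓ < (U ∩ V).card then (2 : ℝ) ^ ((U ∩ V).card) else 0)) /
    (n.choose K : ℝ)

/-- Falling factorials satisfy `K^(j) / n^(j) ≤ (K / n)^j` for `K ≤ n`, cleared of denominators. -/
theorem descFactorial_mul_pow_le {K n : ℕ} (h : K ≤ n) (j : ℕ) :
    K.descFactorial j * n ^ j ≤ n.descFactorial j * K ^ j := by
  induction j with
  | zero => simp
  | succ j ih =>
    have key : (K - j) * n ≤ (n - j) * K := by
      rw [Nat.sub_mul, Nat.sub_mul, mul_comm n K]
      exact Nat.sub_le_sub_left (Nat.mul_le_mul_left j h) _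
    calc K.descFactorial (j + 1) * n ^ (j + 1)
        = ((K - j) * n) * (K.descFactorial j * n ^ j) := by
          rw [Nat.descFactorial_succ]; ring
      _ ≤ ((n - j) * K) * (n.descFactorial j * K ^ j) := Nat.mul_le_mul key ih
      _ = n.descFactorial (j + 1) * K ^ (j + 1) := by
          rw [Nat.descFactorial_succ]; ring

/-- For `K ≤ n`, `C(K, j) / C(n, j) ≤ (K / n)^j`, cleared of denominators. -/
theorem choose_mul_pow_le {K n : ℕ} (h : K ≤ n) (j : ℕ) :
    K.choose j * n ^ j ≤ n.choose j * K ^ j := by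
  have h1 := descFactorial_mul_pow_le h j
  rw [Nat.descFactorial_eq_factorial_mul_choose, Nat.descFactorial_eq_factorial_mul_choose,
    mul_assoc, mul_assoc] at h1
  exact Nat.le_of_mul_le_mul_left h1 j.factorial_pos

/-- The number of `K`-subsets meeting `U` in exactly `x` points is at most
`C(|U|, x) * C(n - |U|, K - x)`. -/
theorem card_filter_card_inter_le {n : ℕ} (K : ℕ) (U : Finset (Fin n)) (x : ℕ) :
    #{V : Finset (Fin n) | #V = K ∧ #(U ∩ V) = x} ≤
      (#U).choose x * (n - #U).choose (K - x) := by
  have hcard : #(powersetCard x U ×ˢ powersetCard (K - x) Uᶜ) =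
      (#U).choose x * (n - #U).choose (K - x) := by
    rw [card_product, card_powersetCard, card_powersetCard, card_compl, Fintype.card_fin]
  rw [← hcard]
  refine card_le_card_of_injOn (fun V => (U ∩ V, V \ U)) ?_ ?_
  · intro V hV
    obtain ⟨hVK, hVx⟩ : #V = K ∧ #(U ∩ V) = x := by simpa using hV
    have h := card_sdiff_add_card_inter V U
    rw [inter_comm] at h
    have h2 : #(V \ U) = K - x := by omega
    simp only [coe_product, Set.mem_prod, mem_coe, mem_powersetCard]
    refine ⟨⟨inter_subset_left, hVx⟩, fun a ha => ?_, h2⟩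
    simp_all
  · intro V _ W _ h
    obtain ⟨h1, h2⟩ := Prod.mk.inj h
    rw [← sdiff_union_inter V U, ← sdiff_union_inter W U, h2, inter_comm V, inter_comm W, h1]

theorem hyperProb_eq_card_filter_div (n K : ℕ) (U : Finset (Fin n)) (x : ℕ) :
    hyperProb n K U x =
      (#{V : Finset (Fin n) | #V = K ∧ #(U ∩ V) = x} : ℝ) / (n.choose K : ℝ) := by
  rw [hyperProb, Nat.card_eq_fintype_card, Fintype.card_subtype]

/-- The hypergeometric point probabilities are at most `(K² / n)^x / x!`. -/
theorem hyperProb_le {n K : ℕ} (hK1 : 1 ≤ K) (hKn : K ≤ n) (U : Finset (Fin n))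
    (hU : #U = K) {x : ℕ} (hx : x ≤ K) :
    hyperProb n K U x ≤ ((K : ℝ) ^ 2 / n) ^ x / (x.factorial : ℝ) := by
  have hn : (0 : ℝ) < n := by exact_mod_cast lt_of_lt_of_le hK1 hKn
  have hcK : (0 : ℝ) < n.choose K := by exact_mod_cast Nat.choose_pos hKn
  have hcx : (0 : ℝ) < n.choose x := by exact_mod_cast Nat.choose_pos (hx.trans hKn)
  have hcount : #{V : Finset (Fin n) | #V = K ∧ #(U ∩ V) = x} ≤
      K.choose x * (n - x).choose (K - x) := by
    refine (card_filter_card_inter_le K U x).trans ?_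
    rw [hU]
    exact Nat.mul_le_mul_left _ (Nat.choose_le_choose _ (by omega))
  have hmul : (n.choose K : ℝ) * K.choose x = n.choose x * (n - x).choose (K - x) := by
    exact_mod_cast Nat.choose_mul (n := n) hx
  have hratio : ((n - x).choose (K - x) : ℝ) / n.choose K ≤ ((K : ℝ) / n) ^ x := by
    have hpow : (K.choose x : ℝ) * n ^ x ≤ n.choose x * K ^ x := by
      exact_mod_cast choose_mul_pow_le hKn x
    have heq : ((n - x).choose (K - x) : ℝ) / n.choose K = K.choose x / n.choose x := by
      rw [div_eq_div_iff hcK.ne' hcx.ne']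
      linarith
    rw [heq, div_pow, div_le_div_iff₀ hcx (by positivity)]
    linarith
  rw [hyperProb_eq_card_filter_div]
  calc (#{V : Finset (Fin n) | #V = K ∧ #(U ∩ V) = x} : ℝ) / n.choose K
      ≤ (K.choose x * (n - x).choose (K - x) : ℝ) / n.choose K := by
        gcongr
        exact_mod_cast hcount
    _ = K.choose x * ((n - x).choose (K - x) / n.choose K) := by rw [mul_div_assoc]
    _ ≤ (K : ℝ) ^ x / x.factorial * ((K : ℝ) / n) ^ x := by
        gcongr
        exact Nat.choose_le_pow_div x K
    _ = ((K : ℝ) ^ 2 / n) ^ x / x.factorial := by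
        rw [div_mul_eq_mul_div, ← mul_pow]
        congr 2
        ring

/-- The truncated expectation, grouped by the value of `|U ∩ V|`. -/
theorem truncExp_eq_sum (n K : ℕ) (U : Finset (Fin n)) (hU : #U = K) (ℓ : ℕ) :
    truncExp n K U ℓ = ∑ x ∈ Icc (ℓ + 1) K, (2 : ℝ) ^ x * hyperProb n K U x := by
  simp_rw [hyperProb_eq_card_filter_div, mul_div_assoc']
  rw [truncExp, ← sum_div, ← sum_filter, filter_filter,
    ← sum_fiberwise_of_maps_to (t := Icc (ℓ + 1) K) (g := fun V => #(U ∩ V))]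
  · congr 1
    refine sum_congr rfl fun x hx => ?_
    rw [mem_Icc] at hx
    have hfiber : ({V ∈ ({V | #V = K ∧ ℓ < #(U ∩ V)} : Finset (Finset (Fin n))) |
        #(U ∩ V) = x}) = ({V | #V = K ∧ #(U ∩ V) = x} : Finset (Finset (Fin n))) := by
      ext V
      simp only [mem_filter, mem_univ, true_and]
      omega
    rw [hfiber, sum_congr rfl (g := fun _ => (2 : ℝ) ^ x), sum_const, nsmul_eq_mul, mul_comm]
    intro V hV
    rw [(mem_filter.1 hV).2.2]
  · intro V hV
    have h := (mem_filter.1 hV).2.2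
    exact mem_Icc.2 ⟨h, hU ▸ card_le_card inter_subset_left⟩

/-- For `1 ≤ K ≤ n`, `U ⊆ [n]` with `|U| = K`, `V` a uniformly random `K`-subset and
`X = |U ∩ V|`: for every `ℓ ≥ 0`,
`E[2^X·1{X>ℓ}] = ∑_{x=ℓ+1}^{K} 2^x·ℙ[X = x] ≤ ∑_{j=ℓ+1}^∞ (2K²/n)^j / j!`. -/
theorem truncated_mgf_bound (n K : ℕ) (hK1 : 1 ≤ K) (hKn : K ≤ n)
    (U : Finset (Fin n)) (hU : U.card = K) (ℓ : ℕ) :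
    truncExp n K U ℓ =
        ∑ x ∈ Finset.Icc (ℓ + 1) K, (2 : ℝ) ^ x * hyperProb n K U x ∧
      truncExp n K U ℓ ≤
        ∑' j : ℕ,
          if ℓ < j then (2 * (K : ℝ) ^ 2 / (n : ℝ)) ^ j / (Nat.factorial j : ℝ) else 0 := by
  refine ⟨truncExp_eq_sum n K U hU ℓ, ?_⟩
  rw [truncExp_eq_sum n K U hU ℓ]
  set c : ℝ := 2 * (K : ℝ) ^ 2 / (n : ℝ) with hc
  have hc0 : 0 ≤ c := by positivity
  have hnonneg : ∀ j : ℕ, 0 ≤ if ℓ < j then c ^ j / (Nat.factorial j : ℝ) else 0 := by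
    intro j
    split_ifs <;> positivity
  have hsummable : Summable fun j : ℕ => if ℓ < j then c ^ j / (Nat.factorial j : ℝ) else 0 := by
    refine (Real.summable_pow_div_factorial c).of_nonneg_of_le hnonneg fun j => ?_
    split_ifs
    · exact le_rfl
    · positivity
  refine le_trans (sum_le_sum fun x hx => ?_)
    (hsummable.sum_le_tsum (Icc (ℓ + 1) K) fun j _ => hnonneg j)
  obtain ⟨hℓx, hxK⟩ := mem_Icc.1 hx
  rw [if_pos (Nat.lt_of_succ_le hℓx)]
  calc (2 : ℝ) ^ x * hyperProb n K U x
      ≤ 2 ^ x * (((K : ℝ) ^ 2 / n) ^ x / x.factorial) := by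
        gcongr
        exact hyperProb_le hK1 hKn U hU hxK
    _ = c ^ x / x.factorial := by
        rw [← mul_div_assoc, ← mul_pow, hc, mul_div_assoc 2]
end

section
/- Let G be a finite simple graph and let U, V be subsets of its vertex set. Call Q ⊆ V(G) a (U,V)-separator if every path in G from a vertex of U to a vertex of V contains a vertex of Q (Q is allowed to intersect U ∪ V, so in particular U and V are themselves separators). Then among the (U,V)-separators of minimum cardinality there exists a unique leftmost one S_L, characterized as the unique minimum (U,V)-separator that is also a (U,Q)-separator for every minimum (U,V)-separator Q; symmetrically, there exists a unique rightmost minimum separator S_R, the unique minimum (U,V)-separator that is a (Q,V)-separator for every minimum (U,V)-separator Q. -/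
open Finset

/-- `Q` is a `(U,V)`-separator in `G`: every path in `G` from a vertex of `U` to a vertex of
`V` contains a vertex of `Q`. (`Q` may intersect `U ∪ V`; a single vertex of `U ∩ V` is a
path, via the nil walk.) -/
def IsSep {α : Type*} (G : SimpleGraph α) (U V Q : Finset α) : Prop :=
  ∀ u ∈ U, ∀ v ∈ V, ∀ p : G.Walk u v, p.IsPath → ∃ q ∈ Q, q ∈ p.support

/-- `Q` is a minimum `(U,V)`-separator: a separator of minimum cardinality. -/
def IsMinSep {α : Type*} (G : SimpleGraph α) (U V Q : Finset α) : Prop :=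
  IsSep G U V Q ∧ ∀ Q', IsSep G U V Q' → Q.card ≤ Q'.card

namespace IsSep

variable {α : Type*} {G : SimpleGraph α} {U V Q : Finset α}

protected theorem right : IsSep G U V V := fun _ _ v hv p _ => ⟨v, hv, p.end_mem_support⟩

protected theorem symm (h : IsSep G U V Q) : IsSep G V U Q := by
  intro v hv u hu p hp
  obtain ⟨q, hq, hqp⟩ := h u hu v hv p.reverse hp.reverse
  exact ⟨q, hq, by simpa using hqp⟩

theorem exists_mem_support [DecidableEq α] (h : IsSep G U V Q) {u v : α} (hu : u ∈ U) (hv : v ∈ V)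
    (p : G.Walk u v) : ∃ q ∈ Q, q ∈ p.support := by
  obtain ⟨q, hq, hqp⟩ := h u hu v hv p.bypass p.bypass_isPath
  exact ⟨q, hq, p.support_bypass_subset_support hqp⟩

end IsSep

/-- The vertices of `X` at which some path starting in `U` meets `X` for the first time. -/
noncomputable def firstHits {α : Type*} (G : SimpleGraph α) (U X : Finset α) : Finset α :=
  open Classical in
  {x ∈ X | ∃ u ∈ U, ∃ p : G.Walk u x, p.IsPath ∧ ∀ y ∈ X, y ∈ p.support → y = x}

section firstHits

variable {α : Type*} {G : SimpleGraph α} {U V X Q : Finset α}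

theorem mem_firstHits {x : α} : x ∈ firstHits G U X ↔ x ∈ X ∧ ∃ u ∈ U, ∃ p : G.Walk u x,
    p.IsPath ∧ ∀ y ∈ X, y ∈ p.support → y = x := by
  simp [firstHits]

theorem firstHits_subset : firstHits G U X ⊆ X := fun _ hx => (mem_firstHits.1 hx).1

variable [DecidableEq α]

theorem IsSep.firstHits_of_subset (hQ : IsSep G U V Q) (hQX : Q ⊆ X) :
    IsSep G U V (firstHits G U X) := by
  intro u hu v hv p hp
  obtain ⟨q, hq, hqp⟩ := hQ u hu v hv p hp
  obtain ⟨x, hx, hxp, hfirst⟩ :=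
    p.exists_mem_support_forall_mem_support_imp_eq X ⟨q, mem_filter.2 ⟨hQX hq, hqp⟩⟩
  exact ⟨x, mem_firstHits.2 ⟨hx, u, hu, p.takeUntil x hxp, hp.takeUntil hxp, hfirst⟩, hxp⟩

theorem IsSep.firstHits_inter_subset (hQ : IsSep G U V Q) (hQX : Q ⊆ X) :
    firstHits G U X ∩ firstHits G V X ⊆ Q := by
  intro x hx
  obtain ⟨hxU, hxV⟩ := mem_inter.1 hx
  obtain ⟨-, u, hu, p, -, hp⟩ := mem_firstHits.1 hxU
  obtain ⟨-, v, hv, q, -, hq⟩ := mem_firstHits.1 hxV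
  obtain ⟨a, ha, hap⟩ := hQ.exists_mem_support hu hv (p.append q.reverse)
  have hax : a = x := by
    rw [SimpleGraph.Walk.mem_support_append_iff, SimpleGraph.Walk.support_reverse,
      List.mem_reverse] at hap
    exact hap.elim (hp a (hQX ha)) (hq a (hQX ha))
  exact hax ▸ ha

end firstHits

namespace IsMinSep

variable {α : Type*} {G : SimpleGraph α} {U V A B Q S : Finset α}

protected theorem symm (h : IsMinSep G U V Q) : IsMinSep G V U Q :=
  ⟨h.1.symm, fun Q' hQ' => h.2 Q' hQ'.symm⟩

variable [DecidableEq α]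

theorem firstHits_union (hA : IsMinSep G U V A) (hB : IsMinSep G U V B) :
    IsMinSep G U V (firstHits G U (A ∪ B)) := by
  have hsep : IsSep G U V (firstHits G U (A ∪ B)) := hA.1.firstHits_of_subset subset_union_left
  have hsep' : IsSep G U V (firstHits G V (A ∪ B)) :=
    (hA.1.symm.firstHits_of_subset subset_union_left).symm
  refine ⟨hsep, fun Q hQ => ?_⟩
  have hinter := card_le_card (subset_inter
    (hA.1.firstHits_inter_subset (X := A ∪ B) subset_union_left)
    (hB.1.firstHits_inter_subset (X := A ∪ B) subset_union_right))
  have hunion := card_le_card (union_subset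
    (firstHits_subset (G := G) (U := U) (X := A ∪ B)) (firstHits_subset (G := G) (U := V)))
  have h₁ := card_union_add_card_inter (firstHits G U (A ∪ B)) (firstHits G V (A ∪ B))
  have h₂ := card_union_add_card_inter A B
  have h₃ := hB.2 _ hsep'
  have h₄ := hA.2 Q hQ
  omega

theorem firstHits_eq (hQ : IsMinSep G U V Q) : firstHits G U Q = Q :=
  eq_of_subset_of_card_le firstHits_subset
    (hQ.2 _ (hQ.1.firstHits_of_subset (Subset.refl Q)))

theorem subset_of_isSep (hS : IsMinSep G U V S) (hSQ : IsSep G U Q S) (hQS : IsSep G U S Q) :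
    S ⊆ Q := by
  intro s hs
  rw [← hS.firstHits_eq] at hs
  obtain ⟨hs, u, hu, p, hp, hfirst⟩ := mem_firstHits.1 hs
  obtain ⟨q, hq, hqp⟩ := hQS u hu s hs p hp
  obtain ⟨t, ht, htp⟩ := hSQ u hu q hq (p.takeUntil q hqp) (hp.takeUntil hqp)
  obtain rfl := hfirst t ht (p.support_takeUntil_subset_support hqp htp)
  by_contra hsQ
  exact SimpleGraph.Walk.endpoint_notMem_support_takeUntil hp hqp
    (fun h => hsQ (h ▸ hq)) htp

end IsMinSep

section leftmost

variable {α : Type*} (G : SimpleGraph α) (U V : Finset α)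

theorem exists_isMinSep : ∃ S, IsMinSep G U V S := by
  obtain ⟨S, hS, hmin⟩ := exists_minimalFor_of_wellFoundedLT (IsSep G U V) card ⟨V, IsSep.right⟩
  exact ⟨S, hS, fun Q hQ => (le_total _ _).elim id (hmin hQ)⟩

variable [DecidableEq α]

theorem exists_isMinSep_forall_mem_isSep (T : Finset (Finset α))
    (hT : ∀ Q ∈ T, IsMinSep G U V Q) : ∃ S, IsMinSep G U V S ∧ ∀ Q ∈ T, IsSep G U Q S := by
  induction T using Finset.induction_on with
  | empty => simpa using exists_isMinSep G U V
  | insert Q T _ ih =>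
    obtain ⟨S, hS, hST⟩ := ih fun R hR => hT R (mem_insert_of_mem hR)
    refine ⟨_, hS.firstHits_union (hT Q (mem_insert_self Q T)), fun R hR => ?_⟩
    obtain rfl | hR := mem_insert.1 hR
    · exact IsSep.right.firstHits_of_subset subset_union_right
    · exact (hST R hR).firstHits_of_subset subset_union_left

theorem existsUnique_leftmost_isMinSep [Fintype α] : ∃! S : Finset α,
    IsMinSep G U V S ∧ ∀ Q : Finset α, IsMinSep G U V Q → IsSep G U Q S := by
  classical
  obtain ⟨S, hS, hleft⟩ := exists_isMinSep_forall_mem_isSep G U V {Q | IsMinSep G U V Q} (by simp)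
  refine ⟨S, ⟨hS, fun Q hQ => hleft Q (by simpa using hQ)⟩, fun R ⟨hR, hRleft⟩ => ?_⟩
  have hRS := hRleft S hS
  have hSR := hleft R (by simpa using hR)
  exact (hR.subset_of_isSep hRS hSR).antisymm (hS.subset_of_isSep hSR hRS)

end leftmost

/-- In a finite simple graph, for any vertex subsets `U, V` there is a unique leftmost
minimum `(U,V)`-separator `S_L`, characterized as the unique minimum `(U,V)`-separator that
is also a `(U,Q)`-separator for every minimum `(U,V)`-separator `Q`; symmetrically there is a
unique rightmost minimum separator `S_R`, the unique minimum `(U,V)`-separator that is a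
`(Q,V)`-separator for every minimum `(U,V)`-separator `Q`. -/
theorem exists_unique_leftmost_rightmost_min_separator
    {α : Type*} [Fintype α] [DecidableEq α] (G : SimpleGraph α) (U V : Finset α) :
    (∃! S : Finset α,
        IsMinSep G U V S ∧ ∀ Q : Finset α, IsMinSep G U V Q → IsSep G U Q S) ∧
    (∃! S : Finset α,
        IsMinSep G U V S ∧ ∀ Q : Finset α, IsMinSep G U V Q → IsSep G Q V S) := by
  refine ⟨existsUnique_leftmost_isMinSep G U V, ?_⟩
  obtain ⟨S, ⟨hS, hright⟩, huniq⟩ := existsUnique_leftmost_isMinSep G V U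
  exact ⟨S, ⟨hS.symm, fun Q hQ => (hright Q hQ.symm).symm⟩,
    fun R ⟨hR, hRright⟩ => huniq R ⟨hR.symm, fun Q hQ => (hRright Q hQ.symm).symm⟩⟩
end
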